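/- arXiv:2201.05269 — 3 statements merged into one kernel-verified Lean document; each statement's English description precedes it below -/
import Mathlib

section
/- Let I = (c,d) ⊂ ℝ, p ∈ (1,∞), p' = p/(p−1), w : I → (0,∞) measurable with ∫_x^d w^p < ∞ for all x ∈ I, and g measurable on I. Then sup over nonzero f ∈ Cs_{p,w}(I) of |∫_I f g| / ‖f‖_{Ch_{p,w}(I)} is finite if and only if g has a locally absolutely continuous representative g̃ of the form g̃(x) = −∫_x^d Dg̃ for all x ∈ I with Dg̃/w ∈ L^{p'}(I). Moreover, in that case this supremum equals (∫_I |Dg̃/w|^{p'})^{1/p'}. -/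
open MeasureTheory Set Filter

/-- membership in the weighted Cesàro space `Cs_{p,w}((c,d))` (case ν = 1) -/
def memCs (c d p : ℝ) (w f : ℝ → ℝ) : Prop :=
  Measurable f ∧ (∀ x ∈ Ioo c d, IntegrableOn f (Ioc c x)) ∧
    IntegrableOn (fun x => (w x * ∫ t in Ioc c x, |f t|) ^ p) (Ioo c d)

/-- seminorm of the altered Cesàro space `Ch_{p,w}((c,d))` -/
noncomputable def chNorm (c d p : ℝ) (w f : ℝ → ℝ) : ℝ :=
  (∫ x in Ioo c d, |w x * ∫ t in Ioc c x, f t| ^ p) ^ (1/p)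

/-- `g` has a representative `gt` which is locally absolutely continuous with
derivative `v`, of the form `gt x = -∫_x^d v`, with `v/w ∈ L^{p'}`. -/
def goodRep (c d q : ℝ) (w g gt v : ℝ → ℝ) : Prop :=
  Measurable v ∧ (∀ᵐ x ∂(volume.restrict (Ioo c d)), g x = gt x) ∧
    (∀ x ∈ Ioo c d, IntegrableOn v (Ioo x d) ∧ gt x = -∫ t in Ioo x d, v t) ∧
    IntegrableOn (fun x => |v x / w x| ^ q) (Ioo c d)

open Topology in
/-- The countably additive set function of a continuous functional on `L^P` of a finite measure. -/
theorem exists_vectorMeasure_of_dual {α : Type*} [MeasurableSpace α] (μ : Measure α)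
    [IsFiniteMeasure μ] (P : ENNReal) [hP : Fact (1 ≤ P)] (hPt : P ≠ ⊤)
    (φ : Lp ℝ P μ →L[ℝ] ℝ) :
    ∃ ν : SignedMeasure α, ∀ (s : Set α) (hs : MeasurableSet s),
      ν s = φ (indicatorConstLp P hs (measure_ne_top μ s) 1) := by
  classical
  let m : Set α → ℝ := fun s =>
    if hs : MeasurableSet s then φ (indicatorConstLp P hs (measure_ne_top μ s) 1) else 0
  have hm : ∀ (s : Set α) (hs : MeasurableSet s),
      m s = φ (indicatorConstLp P hs (measure_ne_top μ s) 1) := fun s hs => dif_pos hs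
  have hm0 : m ∅ = 0 := by rw [hm ∅ MeasurableSet.empty]; simp
  have hadd : ∀ s t : Set α, MeasurableSet s → MeasurableSet t → Disjoint s t →
      m (s ∪ t) = m s + m t := by
    intro s t hs ht hst
    rw [hm s hs, hm t ht, hm _ (hs.union ht), ← map_add]
    congr 1
    exact indicatorConstLp_disjoint_union hs ht (measure_ne_top μ s) (measure_ne_top μ t) hst 1
  refine ⟨⟨m, hm0, fun s hs => dif_neg hs, ?_⟩, hm⟩
  intro f hf hd
  have hfin : ∀ S : Finset ℕ, ∑ i ∈ S, m (f i) = m (⋃ i ∈ S, f i) := by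
    intro S
    induction S using Finset.induction_on with
    | empty => simp [hm0]
    | insert a S ha ih =>
      rw [Finset.sum_insert ha, ih, Finset.set_biUnion_insert, hadd _ _ (hf a)
        (S.measurableSet_biUnion fun i _ => hf i)]
      rw [Set.disjoint_iUnion₂_right]
      exact fun i hi => hd (fun h => ha (h ▸ hi))
  have hU := MeasurableSet.iUnion hf
  have hUS : ∀ S : Finset ℕ, MeasurableSet (⋃ i ∈ S, f i) :=
    fun S => S.measurableSet_biUnion fun i _ => hf i
  have key : Tendsto (fun S : Finset ℕ => μ (symmDiff (⋃ i ∈ S, f i) (⋃ i, f i)))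
      atTop (𝓝 0) := by
    have h1 : ∀ S : Finset ℕ, μ (symmDiff (⋃ i ∈ S, f i) (⋃ i, f i))
        = μ (⋃ i, f i) - ∑ i ∈ S, μ (f i) := by
      intro S
      have hsub : (⋃ i ∈ S, f i) ⊆ ⋃ i, f i := iUnion₂_subset fun i _ => subset_iUnion f i
      rw [symmDiff_of_le hsub, measure_sdiff hsub (hUS S).nullMeasurableSet (measure_ne_top _ _),
        measure_biUnion_finset (fun i _ j _ hij => hd hij) (fun i _ => hf i)]
    simp_rw [h1]
    have h2 : HasSum (fun i => μ (f i)) (μ (⋃ i, f i)) := by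
      rw [measure_iUnion hd hf]; exact ENNReal.summable.hasSum
    have := ENNReal.Tendsto.sub (tendsto_const_nhds (x := μ (⋃ i, f i))) h2
      (Or.inl (measure_ne_top _ _))
    simpa using this
  have := (φ.continuous.tendsto _).comp (tendsto_indicatorConstLp_set (c := (1 : ℝ)) (hs := hU)
    (hμs := measure_ne_top μ _) (ht := hUS) (hμt := fun _ => measure_ne_top μ _) hPt key)
  change Tendsto (fun S : Finset ℕ => ∑ i ∈ S, m (f i)) _ (𝓝 (m (⋃ i, f i)))
  rw [hm _ hU]
  simp_rw [hfin, fun S => hm _ (hUS S)]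
  exact this

/-- Radon–Nikodym density of a continuous functional on `L^P` of a finite measure. -/
theorem exists_density_of_dual {α : Type*} [MeasurableSpace α] (μ : Measure α)
    [IsFiniteMeasure μ] (P : ENNReal) [hP : Fact (1 ≤ P)] (hPt : P ≠ ⊤)
    (φ : Lp ℝ P μ →L[ℝ] ℝ) :
    ∃ h : α → ℝ, Measurable h ∧ Integrable h μ ∧ ∀ (s : Set α) (hs : MeasurableSet s),
      φ (indicatorConstLp P hs (measure_ne_top μ s) 1) = ∫ x in s, h x ∂μ := by
  obtain ⟨ν, hν⟩ := exists_vectorMeasure_of_dual μ P hPt φ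
  have hac : ν ≪ᵥ μ.toENNRealVectorMeasure := by
    refine VectorMeasure.AbsolutelyContinuous.mk fun s hs h0 => ?_
    rw [Measure.toENNRealVectorMeasure_apply_measurable hs] at h0
    rw [hν s hs]
    have : indicatorConstLp P hs (measure_ne_top μ s) (1 : ℝ) = 0 := by
      rw [← norm_eq_zero, norm_indicatorConstLp (one_pos.trans_le hP.out).ne' hPt]
      have : P.toReal ≠ 0 := (ENNReal.toReal_pos (one_pos.trans_le hP.out).ne' hPt).ne'
      simp [Measure.real, h0, this]
    rw [this, map_zero]
  refine ⟨ν.rnDeriv μ, SignedMeasure.measurable_rnDeriv _ _,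
    SignedMeasure.integrable_rnDeriv _ _, fun s hs => ?_⟩
  rw [← hν s hs, ← withDensityᵥ_apply (SignedMeasure.integrable_rnDeriv _ _) hs,
    SignedMeasure.withDensityᵥ_rnDeriv_eq ν μ hac]

theorem dual_simpleFunc_eq {α : Type*} [MeasurableSpace α] (μ : Measure α)
    [IsFiniteMeasure μ] (P : ENNReal) [hP : Fact (1 ≤ P)]
    (φ : Lp ℝ P μ →L[ℝ] ℝ) (h : α → ℝ) (hi : Integrable h μ)
    (hφ : ∀ (s : Set α) (hs : MeasurableSet s),
      φ (indicatorConstLp P hs (measure_ne_top μ s) 1) = ∫ x in s, h x ∂μ)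
    (u : SimpleFunc α ℝ) :
    φ ((u.memLp_of_isFiniteMeasure P μ).toLp u) = ∫ x, u x * h x ∂μ := by
  induction u using SimpleFunc.induction with
  | const c hs =>
    rename_i s
    have h1 : (((SimpleFunc.const α c).piecewise s hs (SimpleFunc.const α 0)).memLp_of_isFiniteMeasure
        P μ).toLp _ = c • indicatorConstLp P hs (measure_ne_top μ s) (1 : ℝ) := by
      apply Lp.ext
      filter_upwards [MemLp.coeFn_toLp (((SimpleFunc.const α c).piecewise s hs
        (SimpleFunc.const α 0)).memLp_of_isFiniteMeasure P μ), Lp.coeFn_smul c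
        (indicatorConstLp P hs (measure_ne_top μ s) (1 : ℝ)),
        indicatorConstLp_coeFn (p := P) (hs := hs) (hμs := measure_ne_top μ s) (c := (1 : ℝ))]
        with x h1 h2 h3
      rw [h1, h2, Pi.smul_apply, h3]
      by_cases hx : x ∈ s <;> simp [hx]
    rw [h1, map_smul, hφ s hs, smul_eq_mul, ← integral_const_mul, ← integral_indicator hs]
    congr 1
    ext x
    by_cases hx : x ∈ s <;> simp [hx]
  | add hd ih1 ih2 =>
    rename_i f g
    have hb : ∀ k : SimpleFunc α ℝ, Integrable (fun x => k x * h x) μ := by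
      intro k
      obtain ⟨C, hC⟩ := k.exists_forall_norm_le
      exact hi.bdd_mul k.stronglyMeasurable.aestronglyMeasurable (Eventually.of_forall hC)
    have h1 : ((f + g).memLp_of_isFiniteMeasure P μ).toLp _ =
        (f.memLp_of_isFiniteMeasure P μ).toLp _ + (g.memLp_of_isFiniteMeasure P μ).toLp _ := rfl
    rw [h1, map_add, ih1, ih2, ← integral_add (hb f) (hb g)]
    congr 1
    ext x
    simp [add_mul]

theorem norm_toLp_ofReal {α : Type*} [MeasurableSpace α] {μ : Measure α} {p : ℝ} (hp : 0 < p)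
    {f : α → ℝ} (hf : MemLp f (ENNReal.ofReal p) μ) :
    ‖hf.toLp f‖ = (∫ x, |f x| ^ p ∂μ) ^ (1 / p) := by
  have h0 : 0 ≤ ∫ x, |f x| ^ p ∂μ := integral_nonneg fun x => by positivity
  rw [Lp.norm_toLp, hf.eLpNorm_eq_integral_rpow_norm (by simpa using hp) ENNReal.ofReal_ne_top,
    ENNReal.toReal_ofReal hp.le]
  simp only [Real.norm_eq_abs, one_div]
  rw [ENNReal.toReal_ofReal (by positivity)]

theorem rpow_conj_le_of_le_mul_rpow {p q A K : ℝ} (hpq : p.HolderConjugate q) (hA : 0 ≤ A)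
    (hK : 0 ≤ K) (h : A ≤ K * A ^ (1 / p)) : A ≤ K ^ q := by
  rcases hA.eq_or_lt with rfl | hA'
  · positivity
  have h1 : A ^ (1 / q) ≤ K := by
    have h2 : A ^ (1 / q) * A ^ (1 / p) = A := by
      rw [← Real.rpow_add hA', one_div, one_div, add_comm, hpq.inv_add_inv_eq_one, Real.rpow_one]
    have h3 : 0 < A ^ (1 / p) := Real.rpow_pos_of_pos hA' _
    exact le_of_mul_le_mul_right (h2.trans_le h) h3
  calc A = (A ^ (1 / q)) ^ q := by
        rw [← Real.rpow_mul hA, one_div, inv_mul_cancel₀ hpq.symm.ne_zero, Real.rpow_one]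
    _ ≤ K ^ q := Real.rpow_le_rpow (by positivity) h1 hpq.symm.nonneg

/-- Converse Hölder estimate against simple functions. -/
theorem integral_simpleFunc_rpow_le_of_dual {α : Type*} [MeasurableSpace α] (μ : Measure α)
    [IsFiniteMeasure μ] {p q : ℝ} (hpq : p.HolderConjugate q)
    [hP : Fact (1 ≤ ENNReal.ofReal p)] (φ : Lp ℝ (ENNReal.ofReal p) μ →L[ℝ] ℝ) (h : α → ℝ)
    (hm : Measurable h) (hi : Integrable h μ)
    (hφ : ∀ u : SimpleFunc α ℝ,
      φ ((u.memLp_of_isFiniteMeasure (ENNReal.ofReal p) μ).toLp u) = ∫ x, u x * h x ∂μ)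
    (s : SimpleFunc α ℝ) (hs0 : ∀ x, 0 ≤ s x) (hsh : ∀ x, s x ≤ |h x|) :
    ∫ x, s x ^ q ∂μ ≤ ‖φ‖ ^ q := by
  have hq1 : 0 < q - 1 := hpq.symm.sub_one_pos
  let sg : SimpleFunc α ℝ := (SimpleFunc.const α 1).piecewise {x | 0 ≤ h x}
    (measurableSet_le measurable_const hm) (SimpleFunc.const α (-1))
  have hsg : ∀ x, sg x * h x = |h x| := by
    intro x
    by_cases hx : 0 ≤ h x
    · simp [sg, hx, abs_of_nonneg hx]
    · simp [sg, hx, abs_of_neg (not_le.1 hx)]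
  have hsg1 : ∀ x, |sg x| = 1 := by
    intro x
    by_cases hx : 0 ≤ h x <;> simp [sg, hx]
  let u : SimpleFunc α ℝ := sg * s.map (fun y => y ^ (q - 1))
  have hu : ∀ x, u x = sg x * s x ^ (q - 1) := fun x => rfl
  have hint : ∀ k : SimpleFunc α ℝ, Integrable k μ := fun k => k.integrable_of_isFiniteMeasure
  have hsq : Integrable (fun x => s x ^ q) μ := hint (s.map (fun y => y ^ q))
  have hb : Integrable (fun x => u x * h x) μ := by
    obtain ⟨C, hC⟩ := u.exists_forall_norm_le
    exact hi.bdd_mul u.stronglyMeasurable.aestronglyMeasurable (Eventually.of_forall hC)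
  apply rpow_conj_le_of_le_mul_rpow hpq (integral_nonneg fun x => Real.rpow_nonneg (hs0 x) _)
    (norm_nonneg φ)
  have hnorm : ‖(u.memLp_of_isFiniteMeasure (ENNReal.ofReal p) μ).toLp u‖
      = (∫ x, s x ^ q ∂μ) ^ (1 / p) := by
    rw [norm_toLp_ofReal hpq.pos]
    congr 2
    ext x
    rw [hu, abs_mul, hsg1, one_mul, abs_of_nonneg (Real.rpow_nonneg (hs0 x) _),
      ← Real.rpow_mul (hs0 x), hpq.symm.sub_one_mul_conj]
  rw [← hnorm]
  calc ∫ x, s x ^ q ∂μ ≤ ∫ x, u x * h x ∂μ := by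
        refine integral_mono hsq hb fun x => ?_
        change s x ^ q ≤ u x * h x
        rw [hu, mul_right_comm, hsg]
        rcases (hs0 x).eq_or_lt with h0 | h0
        · rw [← h0, Real.zero_rpow hpq.symm.ne_zero, Real.zero_rpow hq1.ne', mul_zero]
        · calc s x ^ q = s x * s x ^ (q - 1) := by
                rw [Real.rpow_sub_one h0.ne', mul_div_cancel₀ _ h0.ne']
            _ ≤ _ := mul_le_mul_of_nonneg_right (hsh x) (by positivity)
    _ = φ _ := (hφ u).symm
    _ ≤ _ := (le_abs_self _).trans (φ.le_opNorm _)

open Topology in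
theorem lintegral_rpow_le_of_dual {α : Type*} [MeasurableSpace α] (μ : Measure α)
    [IsFiniteMeasure μ] {p q : ℝ} (hpq : p.HolderConjugate q)
    [hP : Fact (1 ≤ ENNReal.ofReal p)] (φ : Lp ℝ (ENNReal.ofReal p) μ →L[ℝ] ℝ) (h : α → ℝ)
    (hm : Measurable h) (hi : Integrable h μ)
    (hφ : ∀ u : SimpleFunc α ℝ,
      φ ((u.memLp_of_isFiniteMeasure (ENNReal.ofReal p) μ).toLp u) = ∫ x, u x * h x ∂μ) :
    ∫⁻ x, ‖h x‖ₑ ^ q ∂μ ≤ ENNReal.ofReal (‖φ‖ ^ q) := by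
  have hq0 : 0 ≤ q := hpq.symm.nonneg
  let e := SimpleFunc.eapprox (fun x => ‖h x‖ₑ)
  have he : ∀ n x, e n x ≤ ‖h x‖ₑ := fun n x => by
    rw [← SimpleFunc.iSup_eapprox_apply (f := fun x => ‖h x‖ₑ) hm.enorm x]
    exact le_iSup (fun n => e n x) n
  have hlim : Tendsto (fun n => ∫⁻ x, e n x ^ q ∂μ) atTop (𝓝 (∫⁻ x, ‖h x‖ₑ ^ q ∂μ)) := by
    refine lintegral_tendsto_of_tendsto_of_monotone
      (fun n => ((e n).measurable.pow_const q).aemeasurable) ?_ ?_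
    · exact Eventually.of_forall fun x n m hnm =>
        ENNReal.rpow_le_rpow (SimpleFunc.monotone_eapprox _ hnm x) hq0
    · exact Eventually.of_forall fun x =>
        (SimpleFunc.tendsto_eapprox hm.enorm x).ennrpow_const q
  refine le_of_tendsto' hlim fun n => ?_
  have hr := integral_simpleFunc_rpow_le_of_dual μ hpq φ h hm hi hφ ((e n).map ENNReal.toReal)
    (fun x => ENNReal.toReal_nonneg) (fun x => by
      have := ENNReal.toReal_mono (by simp) (he n x)
      simpa using this)
  calc ∫⁻ x, e n x ^ q ∂μ
      = ∫⁻ x, ENNReal.ofReal (((e n).map ENNReal.toReal x) ^ q) ∂μ := by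
        refine lintegral_congr fun x => ?_
        rw [SimpleFunc.map_apply, ENNReal.toReal_rpow, ENNReal.ofReal_toReal]
        exact ENNReal.rpow_ne_top_of_nonneg hq0 (SimpleFunc.eapprox_lt_top _ n x).ne
    _ = ENNReal.ofReal (∫ x, ((e n).map ENNReal.toReal x) ^ q ∂μ) := by
        rw [ofReal_integral_eq_lintegral_ofReal]
        · exact (((e n).map ENNReal.toReal).map (fun y => y ^ q)).integrable_of_isFiniteMeasure
        · exact Eventually.of_forall fun x => Real.rpow_nonneg ENNReal.toReal_nonneg _
    _ ≤ _ := ENNReal.ofReal_le_ofReal hr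

/-- **Riesz representation** of functionals on `L^p`, `1 < p < ∞`, for a finite measure. -/
theorem exists_memLp_integral_eq_dual {α : Type*} [MeasurableSpace α] (μ : Measure α)
    [IsFiniteMeasure μ] {p q : ℝ} (hpq : p.HolderConjugate q)
    [hP : Fact (1 ≤ ENNReal.ofReal p)] (φ : Lp ℝ (ENNReal.ofReal p) μ →L[ℝ] ℝ) :
    ∃ h : α → ℝ, Measurable h ∧ MemLp h (ENNReal.ofReal q) μ ∧
      (∫ x, |h x| ^ q ∂μ) ^ (1 / q) ≤ ‖φ‖ ∧
      ∀ F : Lp ℝ (ENNReal.ofReal p) μ, φ F = ∫ x, F x * h x ∂μ := by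
  obtain ⟨h, hm, hi, hφ⟩ := exists_density_of_dual μ _ ENNReal.ofReal_ne_top φ
  have hφs := dual_simpleFunc_eq μ _ φ h hi hφ
  have hl := lintegral_rpow_le_of_dual μ hpq φ h hm hi hφs
  have hmem : MemLp h (ENNReal.ofReal q) μ := by
    refine ⟨hm.aestronglyMeasurable, ?_⟩
    rw [eLpNorm_lt_top_iff_lintegral_rpow_enorm_lt_top (by simpa using hpq.symm.pos)
      ENNReal.ofReal_ne_top, ENNReal.toReal_ofReal hpq.symm.nonneg]
    exact hl.trans_lt ENNReal.ofReal_lt_top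
  refine ⟨h, hm, hmem, ?_, ?_⟩
  · have hA : ∫ x, |h x| ^ q ∂μ ≤ ‖φ‖ ^ q := by
      rw [integral_eq_lintegral_of_nonneg_ae (Eventually.of_forall fun x => by positivity)
        (hm.abs.pow_const q).aestronglyMeasurable]
      refine ENNReal.toReal_le_of_le_ofReal (by positivity) (le_trans (le_of_eq ?_) hl)
      refine lintegral_congr fun x => ?_
      rw [← ENNReal.ofReal_rpow_of_nonneg (abs_nonneg _) hpq.symm.nonneg, ← Real.norm_eq_abs,
        ofReal_norm]
    calc (∫ x, |h x| ^ q ∂μ) ^ (1 / q) ≤ (‖φ‖ ^ q) ^ (1 / q) :=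
          Real.rpow_le_rpow (integral_nonneg fun x => by positivity) hA
            (one_div_nonneg.2 hpq.symm.nonneg)
      _ = ‖φ‖ := by
          rw [← Real.rpow_mul (norm_nonneg _), mul_one_div_cancel hpq.symm.ne_zero, Real.rpow_one]
  · have : Fact (1 ≤ ENNReal.ofReal q) := ⟨by simpa using hpq.symm.lt.le⟩
    have := hpq.ennrealOfReal
    have := hpq.symm.ennrealOfReal
    let ψ := (ContinuousLinearMap.mul ℝ ℝ).lpPairing μ (ENNReal.ofReal q) (ENNReal.ofReal p)
      (hmem.toLp h)
    have hψ : ∀ F, ψ F = ∫ x, F x * h x ∂μ := by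
      intro F
      rw [ContinuousLinearMap.lpPairing_eq_integral]
      refine integral_congr_ae ?_
      filter_upwards [hmem.coeFn_toLp] with x hx
      rw [hx, ContinuousLinearMap.mul_apply', mul_comm]
    intro F
    rw [← hψ]
    refine (Lp.simpleFunc.denseRange ENNReal.ofReal_ne_top).induction_on F
      (isClosed_eq φ.continuous ψ.continuous) fun f => ?_
    have hf : (f : Lp ℝ (ENNReal.ofReal p) μ) =
        ((Lp.simpleFunc.toSimpleFunc f).memLp_of_isFiniteMeasure (ENNReal.ofReal p) μ).toLp _ := by
      conv_lhs => rw [← Lp.simpleFunc.toLp_toSimpleFunc f]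
    rw [hf, hφs, hψ]
    refine integral_congr_ae ?_
    filter_upwards [((Lp.simpleFunc.toSimpleFunc f).memLp_of_isFiniteMeasure
      (ENNReal.ofReal p) μ).coeFn_toLp] with x hx
    rw [hx]

theorem exists_dual_factor {E X : Type*} [AddCommGroup E] [Module ℝ E] [NormedAddCommGroup X]
    [NormedSpace ℝ X] (T : E →ₗ[ℝ] X) (l : E →ₗ[ℝ] ℝ) {C : ℝ} (hC : 0 ≤ C)
    (h : ∀ e, |l e| ≤ C * ‖T e‖) :
    ∃ φ : X →L[ℝ] ℝ, ‖φ‖ ≤ C ∧ ∀ e, φ (T e) = l e := by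
  have hker : LinearMap.ker T ≤ LinearMap.ker l := by
    intro e he
    rw [LinearMap.mem_ker] at he ⊢
    simpa [he] using h e
  let ψ : LinearMap.range T →ₗ[ℝ] ℝ :=
    (LinearMap.ker T).liftQ l hker ∘ₗ T.quotKerEquivRange.symm.toLinearMap
  have hψ : ∀ e, ψ ⟨T e, LinearMap.mem_range_self T e⟩ = l e := by
    intro e
    have : T.quotKerEquivRange.symm ⟨T e, LinearMap.mem_range_self T e⟩
        = (LinearMap.ker T).mkQ e := T.quotKerEquivRange_symm_apply_image e _
    simp [ψ, this]
  obtain ⟨φ, hφ, hφC⟩ := Module.Dual.exists_extension_of_le_seminorm_real (LinearMap.range T) ψ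
    (p := C.toNNReal • normSeminorm ℝ X) (by
      rintro ⟨_, e, rfl⟩
      rw [hψ]
      refine (le_abs_self _).trans ((h e).trans_eq ?_)
      simp [NNReal.smul_def, hC])
  have hφC' : ∀ x, ‖φ x‖ ≤ C * ‖x‖ := fun x => by
    simpa [NNReal.smul_def, hC] using hφC x
  refine ⟨φ.mkContinuous C hφC', φ.mkContinuous_norm_le hC _, fun e => ?_⟩
  rw [LinearMap.mkContinuous_apply, ← hψ e]
  exact hφ ⟨T e, LinearMap.mem_range_self T e⟩

theorem measurable_setIntegral_Ioc {f : ℝ → ℝ} (hf : Measurable f) (c : ℝ) :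
    Measurable fun x => ∫ t in Ioc c x, f t := by
  have h1 : (fun x => ∫ t in Ioc c x, f t)
      = fun x => ∫ t, {z : ℝ × ℝ | c < z.2 ∧ z.2 ≤ z.1}.indicator (fun z => f z.2) (x, t) := by
    ext x
    rw [← integral_indicator measurableSet_Ioc]
    rfl
  have hm : MeasurableSet {z : ℝ × ℝ | c < z.2 ∧ z.2 ≤ z.1} :=
    (measurableSet_lt measurable_const measurable_snd).inter
      (measurableSet_le measurable_snd measurable_fst)
  rw [h1]
  have h2 := ((hf.comp measurable_snd).indicator hm).stronglyMeasurable.integral_prod_right'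
    (ν := volume)
  exact h2.measurable

/-- Exchange of the order of integration over the triangle `c < x < t < d`. -/
theorem integral_mul_setIntegral_Ioo_swap {c d : ℝ} {f v : ℝ → ℝ} (hf : Measurable f)
    (hv : Measurable v) (hfi : ∀ t ∈ Ioo c d, IntegrableOn f (Ioc c t))
    (hvi : IntegrableOn (fun t => v t * ∫ x in Ioc c t, |f x|) (Ioo c d)) :
    IntegrableOn (fun x => f x * ∫ t in Ioo x d, v t) (Ioo c d) ∧
      ∫ x in Ioo c d, f x * ∫ t in Ioo x d, v t = ∫ t in Ioo c d, v t * ∫ x in Ioc c t, f x := by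
  set μ := volume.restrict (Ioo c d) with hμ
  let K : ℝ × ℝ → ℝ := {z : ℝ × ℝ | z.1 < z.2}.indicator fun z => f z.1 * v z.2
  have hKm : Measurable K :=
    ((hf.comp measurable_fst).mul (hv.comp measurable_snd)).indicator
      (measurableSet_lt measurable_fst measurable_snd)
  have hK1 : ∀ t : ℝ, (fun x => K (x, t)) = (Iio t).indicator fun x => f x * v t := fun t => rfl
  have hK2 : ∀ x : ℝ, (fun t => K (x, t)) = (Ioi x).indicator fun t => f x * v t := fun t => rfl
  have hr : ∀ t ∈ Ioo c d, (μ.restrict (Iio t)) = volume.restrict (Ioo c t) := by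
    intro t ht
    rw [hμ, Measure.restrict_restrict measurableSet_Iio]
    congr 1
    ext x
    simp only [mem_inter_iff, mem_Iio, mem_Ioo]
    exact ⟨fun h => ⟨h.2.1, h.1⟩, fun h => ⟨h.2, h.1, h.2.trans ht.2⟩⟩
  have hs1 : ∀ t ∈ Ioo c d, Integrable (fun x => K (x, t)) μ := by
    intro t ht
    rw [hK1, integrable_indicator_iff measurableSet_Iio, IntegrableOn, hr t ht]
    exact ((hfi t ht).mono_set Ioo_subset_Ioc_self).mul_const _
  have hi1 : ∀ t ∈ Ioo c d, ∫ x, K (x, t) ∂μ = v t * ∫ x in Ioc c t, f x := by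
    intro t ht
    rw [hK1, integral_indicator measurableSet_Iio, hr t ht, integral_mul_const,
      integral_Ioc_eq_integral_Ioo, mul_comm]
  have hi1' : ∀ t ∈ Ioo c d, ∫ x, ‖K (x, t)‖ ∂μ = |v t| * ∫ x in Ioc c t, |f x| := by
    intro t ht
    have : (fun x => ‖K (x, t)‖) = (Iio t).indicator fun x => |f x| * |v t| := by
      ext x
      by_cases hx : x < t <;> simp [K, hx]
    rw [this, integral_indicator measurableSet_Iio, hr t ht, integral_mul_const,
      integral_Ioc_eq_integral_Ioo, mul_comm]
  have hi2 : ∀ x ∈ Ioo c d, ∫ t, K (x, t) ∂μ = f x * ∫ t in Ioo x d, v t := by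
    intro x hx
    rw [hK2, integral_indicator measurableSet_Ioi, hμ, Measure.restrict_restrict measurableSet_Ioi,
      integral_const_mul]
    congr 3
    ext t
    simp only [mem_inter_iff, mem_Ioi, mem_Ioo]
    exact ⟨fun h => ⟨h.1, h.2.2⟩, fun h => ⟨h.1, hx.1.trans h.1, h.2⟩⟩
  have hae : ∀ᵐ x ∂μ, x ∈ Ioo c d := ae_restrict_mem measurableSet_Ioo
  have hK : Integrable K (μ.prod μ) := by
    rw [integrable_prod_iff' hKm.aestronglyMeasurable]
    refine ⟨hae.mono hs1, ?_⟩
    refine Integrable.congr hvi.norm ?_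
    filter_upwards [hae] with t ht
    rw [hi1' t ht, norm_mul, Real.norm_eq_abs, Real.norm_eq_abs,
      abs_of_nonneg (a := ∫ x in Ioc c t, |f x|) (integral_nonneg fun x => abs_nonneg _)]
  refine ⟨hK.integral_prod_left.congr (hae.mono hi2), ?_⟩
  rw [← integral_congr_ae (hae.mono hi2), ← integral_congr_ae (hae.mono hi1)]
  exact integral_integral_swap hK

theorem memLp_ofReal_of_integrable_abs_rpow {α : Type*} [MeasurableSpace α] {μ : Measure α}
    {p : ℝ} (hp : 0 < p) {f : α → ℝ} (hf : AEStronglyMeasurable f μ)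
    (h : Integrable (fun x => |f x| ^ p) μ) : MemLp f (ENNReal.ofReal p) μ := by
  rw [← integrable_norm_rpow_iff hf (by simpa using hp) ENNReal.ofReal_ne_top,
    ENNReal.toReal_ofReal hp.le]
  exact h

theorem memCs.memLp_abs {c d p : ℝ} {w f : ℝ → ℝ} (hp : 0 < p) (hwm : Measurable w)
    (hwpos : ∀ x ∈ Ioo c d, 0 < w x) (hf : memCs c d p w f) :
    MemLp (fun x => w x * ∫ t in Ioc c x, |f t|) (ENNReal.ofReal p)
      (volume.restrict (Ioo c d)) := by
  refine memLp_ofReal_of_integrable_abs_rpow hp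
    (hwm.mul (measurable_setIntegral_Ioc hf.1.abs c)).aestronglyMeasurable ?_
  refine Integrable.congr hf.2.2 ?_
  filter_upwards [ae_restrict_mem measurableSet_Ioo] with x hx
  rw [abs_of_nonneg (mul_nonneg (hwpos x hx).le (integral_nonneg fun t => abs_nonneg _))]

theorem memCs.memLp {c d p : ℝ} {w f : ℝ → ℝ} (hp : 0 < p) (hwm : Measurable w)
    (hwpos : ∀ x ∈ Ioo c d, 0 < w x) (hf : memCs c d p w f) :
    MemLp (fun x => w x * ∫ t in Ioc c x, f t) (ENNReal.ofReal p)
      (volume.restrict (Ioo c d)) := by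
  refine (hf.memLp_abs hp hwm hwpos).mono
    (hwm.mul (measurable_setIntegral_Ioc hf.1 c)).aestronglyMeasurable ?_
  refine Eventually.of_forall fun x => ?_
  rw [norm_mul, norm_mul]
  refine mul_le_mul_of_nonneg_left ?_ (norm_nonneg _)
  exact (norm_integral_le_integral_norm _).trans (le_abs_self _)

theorem integral_mul_primitive_le {c d p q : ℝ} (hpq : p.HolderConjugate q) {w f v : ℝ → ℝ}
    (hwm : Measurable w) (hwpos : ∀ x ∈ Ioo c d, 0 < w x) (hf : memCs c d p w f)
    (hv : Measurable v) (hvw : IntegrableOn (fun x => |v x / w x| ^ q) (Ioo c d)) :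
    IntegrableOn (fun t => v t * ∫ x in Ioc c t, |f x|) (Ioo c d) ∧
      |∫ t in Ioo c d, v t * ∫ x in Ioc c t, f x| ≤
        (∫ x in Ioo c d, |v x / w x| ^ q) ^ (1 / q) * chNorm c d p w f := by
  have hvL := memLp_ofReal_of_integrable_abs_rpow hpq.symm.pos
    (hv.div hwm).aestronglyMeasurable hvw
  have hG := hf.memLp_abs hpq.pos hwm hwpos
  have hF := hf.memLp hpq.pos hwm hwpos
  have := hpq.symm.ennrealOfReal
  have hcanc : ∀ x ∈ Ioo c d, ∀ y : ℝ, (v x / w x) * (w x * y) = v x * y := by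
    intro x hx y
    have := (hwpos x hx).ne'
    field_simp
  constructor
  · refine Integrable.congr (hvL.integrable_mul hG) ?_
    filter_upwards [ae_restrict_mem measurableSet_Ioo] with x hx
    exact hcanc x hx _
  · calc |∫ t in Ioo c d, v t * ∫ x in Ioc c t, f x|
        = ‖∫ t in Ioo c d, (v t / w t) * (w t * ∫ x in Ioc c t, f x)‖ := by
          rw [Real.norm_eq_abs]
          congr 1
          exact setIntegral_congr_fun measurableSet_Ioo fun x hx => (hcanc x hx _).symm
      _ ≤ ∫ t in Ioo c d, ‖(v t / w t) * (w t * ∫ x in Ioc c t, f x)‖ :=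
          norm_integral_le_integral_norm _
      _ = ∫ t in Ioo c d, ‖v t / w t‖ * ‖w t * ∫ x in Ioc c t, f x‖ := by simp_rw [norm_mul]
      _ ≤ _ := integral_mul_norm_le_Lp_mul_Lq hpq.symm hvL hF

theorem goodRep.integral_le {c d p q : ℝ} (hpq : p.HolderConjugate q) {w f g gt v : ℝ → ℝ}
    (hwm : Measurable w) (hwpos : ∀ x ∈ Ioo c d, 0 < w x) (hf : memCs c d p w f)
    (hg : goodRep c d q w g gt v) :
    IntegrableOn (fun x => f x * g x) (Ioo c d) ∧ |∫ x in Ioo c d, f x * g x| ≤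
      (∫ x in Ioo c d, |v x / w x| ^ q) ^ (1 / q) * chNorm c d p w f := by
  obtain ⟨hv, hgg, hgt, hvw⟩ := hg
  obtain ⟨h1, h2⟩ := integral_mul_primitive_le hpq hwm hwpos hf hv hvw
  obtain ⟨h3, h4⟩ := integral_mul_setIntegral_Ioo_swap hf.1 hv hf.2.1 h1
  have hae : (fun x => -(f x * ∫ t in Ioo x d, v t)) =ᵐ[volume.restrict (Ioo c d)]
      fun x => f x * g x := by
    filter_upwards [hgg, ae_restrict_mem measurableSet_Ioo] with x hx hxI
    rw [hx, (hgt x hxI).2, mul_neg]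
  refine ⟨h3.neg.congr hae, ?_⟩
  rw [← integral_congr_ae hae, integral_neg, abs_neg, h4]
  exact h2

/-- Bounded measurable functions vanishing near the left end point `c`. -/
def testSpace {c d : ℝ} (hcd : c < d) : Submodule ℝ (ℝ → ℝ) where
  carrier := {f | Measurable f ∧ ∃ a ∈ Ioo c d, ∃ M : ℝ, ∀ x, |f x| ≤ M ∧ (x ≤ a → f x = 0)}
  zero_mem' := by
    obtain ⟨a, ha⟩ := nonempty_Ioo.2 hcd
    exact ⟨measurable_const, a, ha, 0, fun x => by simp⟩
  add_mem' := by
    rintro f g ⟨hf, a, ha, M, hM⟩ ⟨hg, b, hb, N, hN⟩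
    refine ⟨hf.add hg, min a b, ⟨lt_min ha.1 hb.1, (min_le_left _ _).trans_lt ha.2⟩, M + N,
      fun x => ⟨(abs_add_le _ _).trans (add_le_add (hM x).1 (hN x).1), fun hx => ?_⟩⟩
    rw [Pi.add_apply, (hM x).2 (hx.trans (min_le_left _ _)), (hN x).2 (hx.trans (min_le_right _ _)),
      add_zero]
  smul_mem' := by
    rintro r f ⟨hf, a, ha, M, hM⟩
    refine ⟨hf.const_smul r, a, ha, |r| * M, fun x => ⟨?_, fun hx => ?_⟩⟩
    · rw [Pi.smul_apply, smul_eq_mul, abs_mul]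
      exact mul_le_mul_of_nonneg_left (hM x).1 (abs_nonneg _)
    · rw [Pi.smul_apply, (hM x).2 hx, smul_zero]

theorem memCs_of_mem_testSpace {c d p : ℝ} {w f : ℝ → ℝ} (hcd : c < d) (hp : 0 < p)
    (hwm : Measurable w) (hwpos : ∀ x ∈ Ioo c d, 0 < w x)
    (hwint : ∀ x ∈ Ioo c d, IntegrableOn (fun t => w t ^ p) (Ioo x d))
    (hf : f ∈ testSpace hcd) : memCs c d p w f := by
  obtain ⟨hfm, a, ha, M, hM⟩ := hf
  have hfi : ∀ x, IntegrableOn f (Ioc c x) := fun x =>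
    Measure.integrableOn_of_bounded (M := M) measure_Ioc_lt_top.ne hfm.aestronglyMeasurable
      (Eventually.of_forall fun t => (hM t).1)
  have hM0 : 0 ≤ M := (abs_nonneg _).trans (hM c).1
  refine ⟨hfm, fun x _ => hfi x, ?_⟩
  have hG0 : ∀ x, 0 ≤ ∫ t in Ioc c x, |f t| := fun x => integral_nonneg fun t => abs_nonneg _
  have hGle : ∀ x ∈ Ioo c d, ∫ t in Ioc c x, |f t| ≤ M * (d - c) := by
    intro x hx
    calc ∫ t in Ioc c x, |f t| ≤ ∫ t in Ioc c x, M :=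
          integral_mono (hfi x).abs (integrable_const _) fun t => (hM t).1
      _ = M * (x - c) := by simp [Measure.real, hx.1.le, mul_comm]
      _ ≤ M * (d - c) := by gcongr; exact hx.2.le
  have hGz : ∀ x, x ≤ a → ∫ t in Ioc c x, |f t| = 0 := by
    intro x hx
    rw [setIntegral_congr_fun (g := fun _ => (0 : ℝ)) measurableSet_Ioc fun t ht => by
      simp [(hM t).2 (ht.2.trans hx)]]
    simp
  have hdom : Integrable ((Ioo a d).indicator fun t => (M * (d - c)) ^ p * w t ^ p)
      (volume.restrict (Ioo c d)) :=
    ((integrable_indicator_iff measurableSet_Ioo).2 ((hwint a ha).const_mul _)).restrict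
  refine hdom.mono'
    ((hwm.mul (measurable_setIntegral_Ioc hfm.abs c)).pow_const p).aestronglyMeasurable ?_
  filter_upwards [ae_restrict_mem measurableSet_Ioo] with x hx
  have hw0 := (hwpos x hx).le
  rw [Real.norm_eq_abs, abs_of_nonneg (Real.rpow_nonneg (mul_nonneg hw0 (hG0 x)) _)]
  by_cases hxa : x ≤ a
  · rw [hGz x hxa, mul_zero, Real.zero_rpow hp.ne']
    exact indicator_nonneg (fun t ht => mul_nonneg
      (Real.rpow_nonneg (mul_nonneg hM0 (sub_pos.2 hcd).le) _)
      (Real.rpow_nonneg (hwpos t ⟨ha.1.trans ht.1, ht.2⟩).le _)) x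
  · rw [indicator_of_mem (show x ∈ Ioo a d from ⟨not_le.1 hxa, hx.2⟩),
      ← Real.mul_rpow (mul_nonneg hM0 (sub_pos.2 hcd).le) hw0]
    refine Real.rpow_le_rpow (mul_nonneg hw0 (hG0 x)) ?_ hp.le
    rw [mul_comm]
    exact mul_le_mul_of_nonneg_right (hGle x hx) hw0

theorem ae_restrict_Ioo_of_forall {c d : ℝ} (hcd : c < d) {Q : ℝ → Prop}
    (h : ∀ a ∈ Ioo c d, ∀ᵐ x ∂(volume.restrict (Ioo a d)), Q x) :
    ∀ᵐ x ∂(volume.restrict (Ioo c d)), Q x := by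
  obtain ⟨u, -, hu, hlim⟩ := exists_seq_strictAnti_tendsto' hcd
  have : Ioo c d ⊆ ⋃ n, Ioo (u n) d := by
    intro x hx
    obtain ⟨n, hn⟩ := (hlim.eventually (gt_mem_nhds hx.1)).exists
    exact mem_iUnion.2 ⟨n, hn, hx.2⟩
  refine ae_restrict_of_ae_restrict_of_subset this ?_
  rw [ae_restrict_iUnion_iff]
  exact fun n => h _ (hu n)

theorem norm_toLp_memCs {c d p : ℝ} {w f : ℝ → ℝ} (hp : 0 < p) (hwm : Measurable w)
    (hwpos : ∀ x ∈ Ioo c d, 0 < w x) (hf : memCs c d p w f) :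
    ‖(hf.memLp hp hwm hwpos).toLp _‖ = chNorm c d p w f :=
  norm_toLp_ofReal hp _

/-- The functional `f ↦ ∫ f g` on the test functions is represented in `L^q`. -/
theorem exists_density_on_testSpace {c d p q C : ℝ} (hcd : c < d) (hpq : p.HolderConjugate q)
    (hC : 0 ≤ C) {w g : ℝ → ℝ} (hwm : Measurable w) (hwpos : ∀ x ∈ Ioo c d, 0 < w x)
    (hwint : ∀ x ∈ Ioo c d, IntegrableOn (fun t => w t ^ p) (Ioo x d))
    (hg : ∀ f : ℝ → ℝ, memCs c d p w f → IntegrableOn (fun x => f x * g x) (Ioo c d) ∧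
      |∫ x in Ioo c d, f x * g x| ≤ C * chNorm c d p w f) :
    ∃ h : ℝ → ℝ, Measurable h ∧ MemLp h (ENNReal.ofReal q) (volume.restrict (Ioo c d)) ∧
      (∫ x in Ioo c d, |h x| ^ q) ^ (1 / q) ≤ C ∧
      ∀ f ∈ testSpace hcd, ∫ x in Ioo c d, f x * g x =
        ∫ x in Ioo c d, (w x * ∫ t in Ioc c x, f t) * h x := by
  have hP : Fact (1 ≤ ENNReal.ofReal p) := ⟨by simpa using hpq.lt.le⟩
  have hcs : ∀ f : testSpace hcd, memCs c d p w f := fun f =>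
    memCs_of_mem_testSpace hcd hpq.pos hwm hwpos hwint f.2
  let T : testSpace hcd →ₗ[ℝ] Lp ℝ (ENNReal.ofReal p) (volume.restrict (Ioo c d)) :=
    { toFun := fun f => ((hcs f).memLp hpq.pos hwm hwpos).toLp _
      map_add' := fun f₁ f₂ => by
        rw [← MemLp.toLp_add]
        refine MemLp.toLp_congr _ _ ?_
        filter_upwards [ae_restrict_mem measurableSet_Ioo] with x hx
        change w x * ∫ t in Ioc c x, (f₁ : ℝ → ℝ) t + (f₂ : ℝ → ℝ) t = _ + _
        rw [integral_add ((hcs f₁).2.1 x hx) ((hcs f₂).2.1 x hx), mul_add]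
      map_smul' := fun r f => by
        rw [RingHom.id_apply, ← MemLp.toLp_const_smul]
        refine MemLp.toLp_congr _ _ (Eventually.of_forall fun x => ?_)
        change w x * ∫ t in Ioc c x, r * (f : ℝ → ℝ) t = r * _
        rw [integral_const_mul, mul_left_comm] }
  let l : testSpace hcd →ₗ[ℝ] ℝ :=
    { toFun := fun f => ∫ x in Ioo c d, (f : ℝ → ℝ) x * g x
      map_add' := fun f₁ f₂ => by
        rw [← integral_add (hg _ (hcs f₁)).1 (hg _ (hcs f₂)).1]
        simp [add_mul]
      map_smul' := fun r f => by
        simp [mul_assoc, integral_const_mul] }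
  obtain ⟨φ, hφC, hφ⟩ := exists_dual_factor T l hC fun f => by
    change |∫ x in Ioo c d, (f : ℝ → ℝ) x * g x| ≤
      C * ‖((hcs f).memLp hpq.pos hwm hwpos).toLp _‖
    rw [norm_toLp_memCs hpq.pos hwm hwpos (hcs f)]
    exact (hg _ (hcs f)).2
  obtain ⟨h, hm, hL, hn, hrep⟩ := exists_memLp_integral_eq_dual _ hpq φ
  refine ⟨h, hm, hL, hn.trans hφC, fun f hf => ?_⟩
  have h1 := hφ ⟨f, hf⟩
  rw [hrep] at h1
  refine h1.symm.trans (integral_congr_ae ?_)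
  filter_upwards [((hcs ⟨f, hf⟩).memLp hpq.pos hwm hwpos).coeFn_toLp] with x hx
  exact congrArg (· * h x) hx

theorem exists_goodRep_of_bound {c d p q C : ℝ} (hcd : c < d) (hpq : p.HolderConjugate q)
    (hC : 0 ≤ C) {w g : ℝ → ℝ} (hwm : Measurable w) (hwpos : ∀ x ∈ Ioo c d, 0 < w x)
    (hwint : ∀ x ∈ Ioo c d, IntegrableOn (fun t => w t ^ p) (Ioo x d))
    (hg : ∀ f : ℝ → ℝ, memCs c d p w f → IntegrableOn (fun x => f x * g x) (Ioo c d) ∧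
      |∫ x in Ioo c d, f x * g x| ≤ C * chNorm c d p w f) :
    ∃ gt v : ℝ → ℝ, goodRep c d q w g gt v ∧
      (∫ x in Ioo c d, |v x / w x| ^ q) ^ (1 / q) ≤ C := by
  obtain ⟨h, hm, hL, hn, hrep⟩ := exists_density_on_testSpace hcd hpq hC hwm hwpos hwint hg
  have := hpq.ennrealOfReal
  let v : ℝ → ℝ := fun x => -(w x * h x)
  have hvm : Measurable v := (hwm.mul hm).neg
  have hvh : ∀ x ∈ Ioo c d, |v x / w x| ^ q = |h x| ^ q := by
    intro x hx
    have := (hwpos x hx).ne'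
    rw [show v x / w x = -h x by simp only [v]; field_simp, abs_neg]
  have hvw : IntegrableOn (fun x => |v x / w x| ^ q) (Ioo c d) := by
    refine (integrableOn_congr_fun hvh measurableSet_Ioo).2 ?_
    have := hL.integrable_norm_rpow (by simpa using hpq.symm.pos) ENNReal.ofReal_ne_top
    rwa [ENNReal.toReal_ofReal hpq.symm.nonneg] at this
  have hvi : ∀ x ∈ Ioo c d, IntegrableOn v (Ioo x d) := by
    intro x hx
    have hw : MemLp w (ENNReal.ofReal p) (volume.restrict (Ioo x d)) := by
      refine memLp_ofReal_of_integrable_abs_rpow hpq.pos hwm.aestronglyMeasurable ?_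
      refine (integrableOn_congr_fun (fun t ht => ?_) measurableSet_Ioo).2 (hwint x hx)
      simp only [abs_of_pos (hwpos t ⟨hx.1.trans ht.1, ht.2⟩)]
    have hh : MemLp h (ENNReal.ofReal q) (volume.restrict (Ioo x d)) :=
      hL.mono_measure (Measure.restrict_mono (Ioo_subset_Ioo_left hx.1.le) le_rfl)
    exact (hw.integrable_mul hh).neg
  let gt : ℝ → ℝ := fun x => -∫ t in Ioo x d, v t
  have hfg : ∀ f ∈ testSpace hcd, IntegrableOn (fun x => f x * (g x - gt x)) (Ioo c d) ∧
      ∫ x in Ioo c d, f x * (g x - gt x) = 0 := by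
    intro f hf
    have hcs := memCs_of_mem_testSpace hcd hpq.pos hwm hwpos hwint hf
    have h1 := (integral_mul_primitive_le hpq hwm hwpos hcs hvm hvw).1
    obtain ⟨h3, h4⟩ := integral_mul_setIntegral_Ioo_swap hcs.1 hvm hcs.2.1 h1
    have heq : (fun x => f x * (g x - gt x))
        = fun x => f x * g x + f x * ∫ t in Ioo x d, v t := by
      ext x
      simp only [gt]
      ring
    rw [heq]
    refine ⟨(hg f hcs).1.add h3, ?_⟩
    rw [integral_add (hg f hcs).1 h3, h4, hrep f hf, ← integral_add]
    · refine (integral_congr_ae (Eventually.of_forall fun x => ?_)).trans (integral_zero ℝ ℝ)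
      simp only [v]
      ring
    · exact (hcs.memLp hpq.pos hwm hwpos).integrable_mul hL
    · refine ((hcs.memLp hpq.pos hwm hwpos).integrable_mul hL).neg.congr
        (Eventually.of_forall fun x => ?_)
      simp only [v, Pi.neg_apply, Pi.mul_apply]
      ring
  refine ⟨gt, v, ⟨hvm, ?_, fun x hx => ⟨hvi x hx, rfl⟩, hvw⟩, ?_⟩
  · refine ae_restrict_Ioo_of_forall hcd fun a ha => ?_
    have hsub : ∀ s : Set ℝ, s ∩ Ioo a d ⊆ Ioo c d := fun s =>
      inter_subset_right.trans (Ioo_subset_Ioo_left ha.1.le)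
    have htest : ∀ s : Set ℝ, MeasurableSet s →
        IntegrableOn (fun x => g x - gt x) (s ∩ Ioo a d) ∧
          ∫ x in s ∩ Ioo a d, (g x - gt x) = 0 := by
      intro s hs
      have hms := hs.inter (measurableSet_Ioo (a := a) (b := d))
      have hmem : (s ∩ Ioo a d).indicator (fun _ => (1 : ℝ)) ∈ testSpace hcd := by
        refine ⟨measurable_const.indicator hms, a, ha, 1, fun x => ⟨?_, fun hx => ?_⟩⟩
        · by_cases hx : x ∈ s ∩ Ioo a d <;> simp [hx]
        · exact indicator_of_notMem (fun h => (h.2.1.trans_le hx).false) _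
      have heq : (fun x => (s ∩ Ioo a d).indicator (fun _ => (1 : ℝ)) x * (g x - gt x))
          = (s ∩ Ioo a d).indicator fun x => g x - gt x := by
        ext x
        by_cases hx : x ∈ s ∩ Ioo a d <;> simp [hx]
      have := hfg _ hmem
      rw [heq, integral_indicator hms, Measure.restrict_restrict hms,
        inter_eq_left.2 (hsub s), IntegrableOn, integrable_indicator_iff hms, IntegrableOn,
        Measure.restrict_restrict hms, inter_eq_left.2 (hsub s)] at this
      exact this
    have hint : Integrable (fun x => g x - gt x) (volume.restrict (Ioo a d)) := by
      have := (htest univ MeasurableSet.univ).1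
      rwa [univ_inter] at this
    have := hint.ae_eq_zero_of_forall_setIntegral_eq_zero fun s hs _ => by
      rw [Measure.restrict_restrict hs]
      exact (htest s hs).2
    filter_upwards [this] with x hx
    exact sub_eq_zero.1 hx
  · rwa [setIntegral_congr_fun measurableSet_Ioo hvh]

open Topology in
theorem ae_eq_zero_of_ae_setIntegral_Ioo_eq_zero {a d : ℝ} {u : ℝ → ℝ} (had : a < d)
    (hu : IntegrableOn u (Ioo a d))
    (h : ∀ᵐ x ∂(volume.restrict (Ioo a d)), ∫ t in Ioo x d, u t = 0) :
    ∀ᵐ x ∂(volume.restrict (Ioo a d)), u x = 0 := by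
  have hui : IntervalIntegrable u volume a d :=
    (intervalIntegrable_iff_integrableOn_Ioo_of_le had.le).2 hu
  have huicc : IntegrableOn u (uIcc a d) := by
    rw [uIcc_of_le had.le, integrableOn_Icc_iff_integrableOn_Ioo]
    exact hu
  set k : ℝ → ℝ := fun x => ∫ t in a..x, u t with hk
  have hkc : ContinuousOn k (Ioo a d) :=
    (intervalIntegral.continuousOn_primitive_interval huicc).mono
      (by rw [uIcc_of_le had.le]; exact Ioo_subset_Icc_self)
  have hae : k =ᵐ[volume.restrict (Ioo a d)] fun _ => k d := by
    filter_upwards [h, ae_restrict_mem measurableSet_Ioo] with x hx hxI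
    have h1 : IntervalIntegrable u volume a x :=
      hui.mono_set (uIcc_subset_uIcc_left (by rw [uIcc_of_le had.le]; exact ⟨hxI.1.le, hxI.2.le⟩))
    have h2 := intervalIntegral.integral_interval_sub_left hui h1
    rw [intervalIntegral.integral_of_le hxI.2.le, integral_Ioc_eq_integral_Ioo, hx] at h2
    exact (sub_eq_zero.1 h2).symm
  have heq : EqOn k (fun _ => k d) (Ioo a d) :=
    Measure.eqOn_open_of_ae_eq hae isOpen_Ioo hkc continuousOn_const
  rw [ae_restrict_iff' measurableSet_Ioo]
  filter_upwards [hui.ae_hasDerivAt_integral] with x hx hxI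
  have hxu : x ∈ uIcc a d := by rw [uIcc_of_le had.le]; exact Ioo_subset_Icc_self hxI
  have h1 : HasDerivAt k (u x) x := hx hxu a left_mem_uIcc
  have h2 : HasDerivAt k 0 x := (hasDerivAt_const x (k d)).congr_of_eventuallyEq
    (eventually_of_mem (isOpen_Ioo.mem_nhds hxI) heq)
  exact h1.unique h2

theorem goodRep.ae_unique {c d q : ℝ} (hcd : c < d) {w g gt v gt' v' : ℝ → ℝ}
    (h : goodRep c d q w g gt v) (h' : goodRep c d q w g gt' v') :
    ∀ᵐ x ∂(volume.restrict (Ioo c d)), v x = v' x := by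
  refine ae_restrict_Ioo_of_forall hcd fun a ha => ?_
  have hsub : Ioo a d ⊆ Ioo c d := Ioo_subset_Ioo_left ha.1.le
  have := ae_eq_zero_of_ae_setIntegral_Ioo_eq_zero (u := fun x => v x - v' x) ha.2
    ((h.2.2.1 a ha).1.sub (h'.2.2.1 a ha).1) (by
      refine ae_restrict_of_ae_restrict_of_subset hsub ?_
      filter_upwards [h.2.1, h'.2.1, ae_restrict_mem measurableSet_Ioo] with x h1 h2 hx
      rw [integral_sub (h.2.2.1 x hx).1 (h'.2.2.1 x hx).1]
      have h3 := (h.2.2.1 x hx).2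
      have h4 := (h'.2.2.1 x hx).2
      linarith)
  filter_upwards [this] with x hx
  exact sub_eq_zero.1 hx

theorem stmt6 (c d p q : ℝ) (hcd : c < d) (hp : 1 < p) (hq : q = p / (p - 1))
    (w : ℝ → ℝ) (hwm : Measurable w)
    (hwpos : ∀ x ∈ Ioo c d, 0 < w x)
    (hwint : ∀ x ∈ Ioo c d, IntegrableOn (fun t => w t ^ p) (Ioo x d))
    (g : ℝ → ℝ) (hgm : Measurable g) :
    ((∃ C : ℝ, 0 ≤ C ∧ ∀ f : ℝ → ℝ, memCs c d p w f →
        IntegrableOn (fun x => f x * g x) (Ioo c d) ∧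
        |∫ x in Ioo c d, f x * g x| ≤ C * chNorm c d p w f) ↔
      ∃ gt v : ℝ → ℝ, goodRep c d q w g gt v)
    ∧
    (∀ gt v : ℝ → ℝ, goodRep c d q w g gt v →
      (⨆ f : ℝ → ℝ, ⨆ _ : memCs c d p w f ∧
          IntegrableOn (fun x => f x * g x) (Ioo c d) ∧ chNorm c d p w f ≠ 0,
        ENNReal.ofReal (|∫ x in Ioo c d, f x * g x| / chNorm c d p w f))
      = ENNReal.ofReal ((∫ x in Ioo c d, |v x / w x| ^ q) ^ (1/q))) := by
  have hpq : p.HolderConjugate q := (Real.holderConjugate_iff_eq_conjExponent hp).2 hq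
  have hN0 : ∀ v : ℝ → ℝ, 0 ≤ (∫ x in Ioo c d, |v x / w x| ^ q) ^ (1 / q) := fun v =>
    Real.rpow_nonneg (integral_nonneg fun x => Real.rpow_nonneg (abs_nonneg _) _) _
  have hch0 : ∀ f : ℝ → ℝ, 0 ≤ chNorm c d p w f := fun f =>
    Real.rpow_nonneg (integral_nonneg fun x => Real.rpow_nonneg (abs_nonneg _) _) _
  refine ⟨⟨?_, ?_⟩, ?_⟩
  · rintro ⟨C, hC, h⟩
    obtain ⟨gt, v, hgv, -⟩ := exists_goodRep_of_bound hcd hpq hC hwm hwpos hwint h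
    exact ⟨gt, v, hgv⟩
  · rintro ⟨gt, v, hgv⟩
    exact ⟨_, hN0 v, fun f hf => hgv.integral_le hpq hwm hwpos hf⟩
  · intro gt v hgv
    set N := (∫ x in Ioo c d, |v x / w x| ^ q) ^ (1 / q) with hN
    set K : ENNReal := ⨆ f : ℝ → ℝ, ⨆ _ : memCs c d p w f ∧
      IntegrableOn (fun x => f x * g x) (Ioo c d) ∧ chNorm c d p w f ≠ 0,
      ENNReal.ofReal (|∫ x in Ioo c d, f x * g x| / chNorm c d p w f)
    have hle : K ≤ ENNReal.ofReal N := by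
      refine iSup₂_le fun f hf => ENNReal.ofReal_le_ofReal ?_
      exact div_le_of_le_mul₀ (hch0 f) (hN0 v) (hgv.integral_le hpq hwm hwpos hf.1).2
    refine hle.antisymm ?_
    have hKt : K ≠ ⊤ := (hle.trans_lt ENNReal.ofReal_lt_top).ne
    have hKf : ∀ f : ℝ → ℝ, memCs c d p w f → IntegrableOn (fun x => f x * g x) (Ioo c d) →
        chNorm c d p w f ≠ 0 →
        ENNReal.ofReal (|∫ x in Ioo c d, f x * g x| / chNorm c d p w f) ≤ K :=
      fun f h1 h2 h3 => le_iSup_of_le f (le_iSup_of_le ⟨h1, h2, h3⟩ le_rfl)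
    clear_value K
    obtain ⟨gt', v', hgv', hb⟩ := exists_goodRep_of_bound (C := K.toReal) (g := g) hcd hpq
      ENNReal.toReal_nonneg hwm hwpos hwint (by
        intro f hf
        obtain ⟨h1, h2⟩ := hgv.integral_le hpq hwm hwpos hf
        refine ⟨h1, ?_⟩
        by_cases h0 : chNorm c d p w f = 0
        · rw [h0, mul_zero] at h2 ⊢
          exact h2
        · rw [← div_le_iff₀ ((hch0 f).lt_of_ne' h0), ← ENNReal.ofReal_le_iff_le_toReal hKt]
          exact hKf f hf h1 h0)
    have hNN : N = (∫ x in Ioo c d, |v' x / w x| ^ q) ^ (1 / q) := by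
      rw [hN]
      congr 1
      refine integral_congr_ae ?_
      filter_upwards [hgv.ae_unique hcd hgv'] with x hx
      rw [hx]
    rw [hNN]
    exact (ENNReal.ofReal_le_iff_le_toReal hKt).2 hb
end

section
/- Let I = (c,d) ⊂ ℝ, p ∈ (1,∞), w : I → (0,∞) measurable with ∫_x^d w^p < ∞ for all x ∈ I. Suppose g measurable on I satisfies J(g) := sup over nonzero f ∈ Ch_{p,w}(I) of |∫_I f g| / ‖f‖_{Ch_{p,w}(I)} < ∞. Then g is essentially bounded on every interval (c, a] with a ∈ I, i.e., g ∈ L^∞((c,a]) for every a ∈ I. -/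
open MeasureTheory Set Filter

/-- membership in the altered Cesàro space `Ch_{p,w}((c,d))` (case ν = 1) -/
def memCh (c d p : ℝ) (w f : ℝ → ℝ) : Prop :=
  Measurable f ∧ (∀ x ∈ Ioo c d, IntegrableOn f (Ioc c x)) ∧
    IntegrableOn (fun x => |w x * ∫ t in Ioc c x, f t| ^ p) (Ioo c d)

theorem exists_normalized_integral_eq_zero (E : Set ℝ) (hE : MeasurableSet E) (u v : ℝ) (huv : u ≤ v)
    (hEs : E ⊆ Ioc u v) (h0 : volume E ≠ 0) :
    ∃ φ : ℝ → ℝ, Measurable φ ∧ Integrable φ ∧ (∀ x ∉ E, φ x = 0) ∧ ∫ x, |φ x| = 1 ∧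
      ∫ x, φ x = 0 := by
  have hfin : volume E ≠ ⊤ := measure_ne_top_of_subset hEs (by simp)
  set h : ℝ → ℝ := E.indicator 1 with hh
  have hhi : Integrable h := (integrable_indicator_iff hE).2 (integrableOn_const hfin)
  have hhint : ∫ x, h x = volume.real E := integral_indicator_one hE
  have hpos : 0 < volume.real E := by
    rw [measureReal_def]; exact ENNReal.toReal_pos h0 hfin
  have hcont : Continuous fun x => ∫ t in u..x, h t :=
    intervalIntegral.continuous_primitive (fun _ _ => hhi.intervalIntegrable) u
  have hv : ∫ t in u..v, h t = volume.real E := by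
    rw [intervalIntegral.integral_of_le huv, ← hhint]
    refine setIntegral_eq_integral_of_forall_compl_eq_zero fun x hx => ?_
    exact indicator_of_notMem (fun hxE => hx (hEs hxE)) _
  obtain ⟨m, ⟨hm1, hm2⟩, hm⟩ : volume.real E / 2 ∈ (fun x => ∫ t in u..x, h t) '' Icc u v := by
    refine intermediate_value_Icc huv hcont.continuousOn ⟨?_, ?_⟩
    · simp only [intervalIntegral.integral_same]; positivity
    · simp only [hv]; linarith
  replace hm : ∫ t in u..m, h t = volume.real E / 2 := hm
  have hm' : ∫ t, (Ioc u m).indicator h t = volume.real E / 2 := by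
    rw [integral_indicator measurableSet_Ioc, ← intervalIntegral.integral_of_le hm1, hm]
  have hI : Integrable ((Ioc u m).indicator h) := hhi.indicator measurableSet_Ioc
  have hhm : Measurable h := measurable_one.indicator hE
  refine ⟨fun x => (volume.real E)⁻¹ * (2 * (Ioc u m).indicator h x - h x), ?_, ?_, ?_, ?_, ?_⟩
  · exact (((hhm.indicator measurableSet_Ioc).const_mul 2).sub hhm).const_mul _
  · exact ((hI.const_mul 2).sub hhi).const_mul _
  · intro x hx
    have : h x = 0 := indicator_of_notMem hx _
    by_cases hxm : x ∈ Ioc u m <;> simp [hxm, this]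
  · have : ∀ x, |(volume.real E)⁻¹ * (2 * (Ioc u m).indicator h x - h x)|
        = (volume.real E)⁻¹ * h x := by
      intro x
      rw [abs_mul, abs_of_pos (inv_pos.2 hpos)]
      congr 1
      by_cases hx : x ∈ E <;> by_cases hxm : x ∈ Ioc u m <;> (simp [hh, hx, hxm]; try norm_num)
    simp_rw [this, integral_const_mul, hhint]
    field_simp
  · rw [integral_const_mul, integral_sub (hI.const_mul 2) hhi, integral_const_mul, hm', hhint]
    ring

theorem exists_Ioc_setLIntegral_le_one (c d : ℝ) (q : ℝ → ENNReal)
    (hq : ∀ x ∈ Ioo c d, ∫⁻ t in Ioo x d, q t ≠ ⊤)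
    (E : Set ℝ) (hEs : E ⊆ Ioo c d) (h0 : volume E ≠ 0) :
    ∃ u v, c < u ∧ u ≤ v ∧ v < d ∧ volume (E ∩ Ioc u v) ≠ 0 ∧ ∫⁻ t in Ioc u v, q t ≤ 1 := by
  obtain ⟨x, hxE, hx⟩ := exists_mem_forall_mem_nhdsWithin_pos_measure h0
  obtain ⟨hcx, hxd⟩ := hEs hxE
  obtain ⟨y, hcy, hyx⟩ := exists_between hcx
  obtain ⟨δ, hδ, hδq⟩ := exists_pos_setLIntegral_lt_of_measure_lt
    (hq y ⟨hcy, hyx.trans hxd⟩) one_ne_zero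
  obtain ⟨r, hr, hrδ⟩ : ∃ r : ℝ, 0 < r ∧ ENNReal.ofReal (2 * r) < δ := by
    have : Tendsto (fun r : ℝ => ENNReal.ofReal (2 * r)) (nhdsWithin 0 (Ioi 0)) (nhds 0) := by
      have : Continuous fun r : ℝ => ENNReal.ofReal (2 * r) :=
        ENNReal.continuous_ofReal.comp (by fun_prop)
      simpa using (this.tendsto 0).mono_left nhdsWithin_le_nhds
    obtain ⟨r, h1, h2⟩ := ((this.eventually (gt_mem_nhds hδ)).and self_mem_nhdsWithin).exists
    exact ⟨r, h2, h1⟩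
  obtain ⟨v, hxv, hv⟩ := exists_between (lt_min hxd (lt_add_of_pos_right x hr))
  obtain ⟨u, hu, hux⟩ := exists_between (max_lt hyx (sub_lt_self x hr))
  obtain ⟨hvd, hvr⟩ := lt_min_iff.1 hv
  obtain ⟨hyu, hur⟩ := max_lt_iff.1 hu
  refine ⟨u, v, hcy.trans hyu, (hux.trans hxv).le, hvd, (hx _ ?_).ne', ?_⟩
  · exact inter_mem self_mem_nhdsWithin (mem_nhdsWithin_of_mem_nhds (Ioc_mem_nhds hux hxv))
  · have hsub : Ioc u v ⊆ Ioo y d := fun t ht => ⟨hyu.trans ht.1, ht.2.trans_lt hvd⟩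
    have := hδq (Ioc u v) (by
      refine (Measure.restrict_apply_le _ _).trans_lt (lt_of_le_of_lt ?_ hrδ)
      rw [Real.volume_Ioc]
      exact ENNReal.ofReal_le_ofReal (by linarith))
    rw [Measure.restrict_restrict measurableSet_Ioc, inter_eq_left.2 hsub] at this
    exact this.le

theorem exists_normalized_small_primitive (c d : ℝ) (q : ℝ → ENNReal)
    (hq : ∀ x ∈ Ioo c d, ∫⁻ t in Ioo x d, q t ≠ ⊤)
    (E : Set ℝ) (hE : MeasurableSet E) (hEs : E ⊆ Ioo c d) (h0 : volume E ≠ 0) :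
    ∃ φ : ℝ → ℝ, Measurable φ ∧ Integrable φ ∧ (∀ x ∉ E, φ x = 0) ∧ ∫ x, |φ x| = 1 ∧
      ∫⁻ x in Ioo c d, q x * ‖∫ t in c..x, φ t‖ₑ ≤ 1 := by
  obtain ⟨u, v, hcu, huv, hvd, hpos, hle⟩ := exists_Ioc_setLIntegral_le_one c d q hq E hEs h0
  obtain ⟨φ, hm, hi, hz, h1, hint⟩ := exists_normalized_integral_eq_zero (E ∩ Ioc u v)
    (hE.inter measurableSet_Ioc) u v huv inter_subset_right hpos
  refine ⟨φ, hm, hi, fun x hx => hz x fun h => hx h.1, h1, le_trans ?_ hle⟩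
  rw [← lintegral_indicator measurableSet_Ioo, ← lintegral_indicator measurableSet_Ioc]
  refine lintegral_mono fun x => ?_
  by_cases hx : x ∈ Ioo c d
  · rw [indicator_of_mem hx, intervalIntegral.integral_of_le hx.1.le]
    by_cases hxu : x ∈ Ioc u v
    · rw [indicator_of_mem hxu]
      refine mul_le_of_le_one_right zero_le 
        ((enorm_le_iff_norm_le (y := (1 : ℝ))).2 ?_ |>.trans_eq enorm_one)
      refine (norm_integral_le_integral_norm _).trans ?_
      rw [norm_one, ← h1]
      exact setIntegral_le_integral hi.norm (ae_of_all _ fun _ => norm_nonneg _)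
    · have : ∫ t in Ioc c x, φ t = 0 := by
        rcases le_or_gt x u with h | h
        · exact setIntegral_eq_zero_of_forall_eq_zero fun t ht =>
            hz t fun h' => absurd h'.2.1 (not_lt.2 (ht.2.trans h))
        · rw [setIntegral_eq_integral_of_forall_compl_eq_zero, hint]
          intro t ht
          refine hz t fun h' => ht ⟨hcu.trans h'.2.1, h'.2.2.trans ?_⟩
          by_contra! hlt
          exact hxu ⟨h, hlt.le⟩
      simp [this]
  · simp [hx]

theorem memCh_tsum (c d p : ℝ) (hp : 1 < p) (w : ℝ → ℝ) (hwm : Measurable w)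
    (hwpos : ∀ x ∈ Ioo c d, 0 < w x) (b : ℕ → ℝ) (hb0 : ∀ n, 0 ≤ b n) (hb : HasSum b 1)
    (φ : ℕ → ℝ → ℝ) (hm : ∀ n, Measurable (φ n)) (hi : ∀ n, Integrable (φ n))
    (h1 : ∀ n, ∫ x, |φ n x| = 1)
    (hq : ∀ n, ∫⁻ x in Ioo c d, ENNReal.ofReal (w x ^ p) * ‖∫ t in c..x, φ n t‖ₑ ≤ 1) :
    memCh c d p w fun x => ∑' n, b n * φ n x := by
  set f : ℝ → ℝ := fun x => ∑' n, b n * φ n x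
  have hfm : Measurable f := Measurable.tsum fun n => (hm n).const_mul (b n)
  have hbe : ∑' n, ENNReal.ofReal (b n) = 1 := by
    rw [← ENNReal.ofReal_tsum_of_nonneg hb0 hb.summable, hb.tsum_eq, ENNReal.ofReal_one]
  have hlin : ∀ n, ∫⁻ x, ‖b n * φ n x‖ₑ = ENNReal.ofReal (b n) := fun n => by
    rw [← ofReal_integral_norm_eq_lintegral_enorm ((hi n).const_mul (b n))]
    simp only [norm_mul, integral_const_mul, Real.norm_eq_abs, h1, mul_one, abs_of_nonneg (hb0 n)]
  have hfl : ∫⁻ x, ‖f x‖ₑ ≤ 1 := calc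
    ∫⁻ x, ‖f x‖ₑ ≤ ∫⁻ x, ∑' n, ‖b n * φ n x‖ₑ := lintegral_mono fun x => enorm_tsum_le_tsum_enorm
    _ = 1 := by
      rw [lintegral_tsum fun n => ((hm n).const_mul (b n)).enorm.aemeasurable]
      simp_rw [hlin, hbe]
  have hfi : Integrable f := ⟨hfm.aestronglyMeasurable, hfl.trans_lt ENNReal.one_lt_top⟩
  refine ⟨hfm, fun x _ => hfi.integrableOn, ?_⟩
  have hprim : ∀ {ψ : ℝ → ℝ}, Integrable ψ → Continuous fun x => ∫ t in c..x, ψ t := fun hψ =>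
    intervalIntegral.continuous_primitive (fun _ _ => hψ.intervalIntegrable) c
  have hle1 : ∀ x, c ≤ x → ‖∫ t in c..x, f t‖ₑ ≤ 1 := fun x hx => by
    rw [intervalIntegral.integral_of_le hx]
    exact (enorm_integral_le_lintegral_enorm _).trans ((setLIntegral_le_lintegral _ _).trans hfl)
  have hsum : ∀ x, c ≤ x →
      ‖∫ t in c..x, f t‖ₑ ≤ ∑' n, ENNReal.ofReal (b n) * ‖∫ t in c..x, φ n t‖ₑ := fun x hx => by
    have : ∫ t in c..x, f t = ∑' n, b n * ∫ t in c..x, φ n t := by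
      simp_rw [intervalIntegral.integral_of_le hx, ← integral_const_mul]
      refine integral_tsum (fun n => ((hm n).const_mul (b n)).aestronglyMeasurable) ?_
      refine ne_top_of_le_ne_top ENNReal.one_ne_top (hbe ▸ ENNReal.tsum_le_tsum fun n => ?_)
      exact (setLIntegral_le_lintegral _ _).trans (hlin n).le
    rw [this]
    refine enorm_tsum_le_tsum_enorm.trans_eq (tsum_congr fun n => ?_)
    rw [enorm_mul, Real.enorm_of_nonneg (hb0 n)]
  have hcongr : EqOn (fun x => |w x * ∫ t in c..x, f t| ^ p)
      (fun x => |w x * ∫ t in Ioc c x, f t| ^ p) (Ioo c d) := fun x hx => by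
    simp only [intervalIntegral.integral_of_le hx.1.le]
  refine IntegrableOn.congr_fun ⟨?_, ?_⟩ hcongr measurableSet_Ioo
  · have := (hprim hfi).measurable
    exact Measurable.aestronglyMeasurable (by fun_prop)
  · refine lt_of_le_of_lt ?_ ENNReal.one_lt_top
    calc ∫⁻ x in Ioo c d, ‖|w x * ∫ t in c..x, f t| ^ p‖ₑ
      _ ≤ ∫⁻ x in Ioo c d, ∑' n, ENNReal.ofReal (b n) *
            (ENNReal.ofReal (w x ^ p) * ‖∫ t in c..x, φ n t‖ₑ) := by
        refine setLIntegral_mono' measurableSet_Ioo fun x hx => ?_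
        have hle := hle1 x hx.1.le
        have key : ‖|w x * ∫ t in c..x, f t| ^ p‖ₑ ≤
            ENNReal.ofReal (w x ^ p) * ‖∫ t in c..x, f t‖ₑ := by
          rw [Real.enorm_of_nonneg (by positivity), abs_mul,
            Real.mul_rpow (abs_nonneg _) (abs_nonneg _), abs_of_pos (hwpos x hx),
            ENNReal.ofReal_mul (Real.rpow_nonneg (hwpos x hx).le _),
            ← ENNReal.ofReal_rpow_of_nonneg (abs_nonneg _) (by linarith), Real.enorm_eq_ofReal_abs]
          rw [Real.enorm_eq_ofReal_abs] at hle
          gcongr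
          exact ENNReal.rpow_le_self_of_le_one hle hp.le
        refine key.trans ?_
        simp_rw [mul_left_comm (ENNReal.ofReal (b _)), ENNReal.tsum_mul_left]
        gcongr
        exact hsum x hx.1.le
      _ = ∑' n, ENNReal.ofReal (b n) *
            ∫⁻ x in Ioo c d, ENNReal.ofReal (w x ^ p) * ‖∫ t in c..x, φ n t‖ₑ := by
        have hmeas : ∀ n, Measurable fun x => ENNReal.ofReal (w x ^ p) * ‖∫ t in c..x, φ n t‖ₑ :=
          fun n => by
            have := (hprim (hi n)).measurable
            fun_prop
        rw [lintegral_tsum fun n => ((hmeas n).const_mul _).aemeasurable]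
        exact tsum_congr fun n => lintegral_const_mul _ (hmeas n)
      _ ≤ ∑' n, ENNReal.ofReal (b n) :=
        ENNReal.tsum_le_tsum fun n => mul_le_of_le_one_right zero_le (hq n)
      _ = 1 := hbe

theorem frequently_measure_floor_ne_zero (g : ℝ → ℝ) (s : Set ℝ)
    (h : ∀ M : ℝ, ¬ ∀ᵐ x ∂(volume.restrict s), |g x| ≤ M) :
    ∃ᶠ k : ℕ in atTop, volume.restrict s {x | ⌊|g x|⌋₊ = k} ≠ 0 := by
  intro hev
  simp only [not_not] at hev
  obtain ⟨N, hN⟩ := eventually_atTop.1 hev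
  refine h N ?_
  have : ∀ᵐ x ∂(volume.restrict s), ∀ k ≥ N, ⌊|g x|⌋₊ ≠ k :=
    ae_all_iff.2 fun k => by
      by_cases hk : N ≤ k
      · simpa [hk, ae_iff] using hN k hk
      · simp [hk]
  filter_upwards [this] with x hx
  by_contra! hlt
  exact hx _ (Nat.le_floor hlt.le) rfl

theorem stmt8 (c d p : ℝ) (hcd : c < d) (hp : 1 < p)
    (w : ℝ → ℝ) (hwm : Measurable w)
    (hwpos : ∀ x ∈ Ioo c d, 0 < w x)
    (hwint : ∀ x ∈ Ioo c d, IntegrableOn (fun t => w t ^ p) (Ioo x d))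
    (g : ℝ → ℝ) (hgm : Measurable g)
    (C : ℝ)
    (hC : ∀ f : ℝ → ℝ, memCh c d p w f →
      IntegrableOn (fun x => f x * g x) (Ioo c d) ∧
      |∫ x in Ioo c d, f x * g x| ≤ C * chNorm c d p w f) :
    ∀ a ∈ Ioo c d, ∃ M : ℝ,
      ∀ᵐ x ∂(volume.restrict (Ioc c a)), |g x| ≤ M := by
  intro a ha
  by_contra hcon
  have hq : ∀ x ∈ Ioo c d, ∫⁻ t in Ioo x d, ENNReal.ofReal (w t ^ p) ≠ ⊤ := fun x hx =>
    ((lintegral_mono fun t => Real.ofReal_le_enorm _).trans_lt (hwint x hx).2).ne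
  obtain ⟨k, hk, hkn⟩ := extraction_forall_of_frequently (P := fun n k =>
      volume.restrict (Ioc c a) {x | ⌊|g x|⌋₊ = k} ≠ 0 ∧ 4 ^ n ≤ k) fun n =>
    (frequently_measure_floor_ne_zero g (Ioc c a) fun M hM => hcon ⟨M, hM⟩).and_eventually
      (eventually_ge_atTop _)
  have hD : ∀ j : ℕ, MeasurableSet {x | ⌊|g x|⌋₊ = j} := fun j =>
    (Nat.measurable_floor.comp hgm.abs) (measurableSet_singleton j)
  have hsub : Ioc c a ⊆ Ioo c d := fun x hx => ⟨hx.1, hx.2.trans_lt ha.2⟩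
  choose φ hm hi hz h1 hqφ using fun n => exists_normalized_small_primitive c d _ hq
    ({x | ⌊|g x|⌋₊ = k n} ∩ Ioc c a) ((hD _).inter measurableSet_Ioc)
    (inter_subset_right.trans hsub) (by simpa [Measure.restrict_apply (hD _)] using (hkn n).1)
  set b : ℕ → ℝ := fun n => 1 / 2 / 2 ^ n with hb
  have hmem := memCh_tsum c d p hp w hwm hwpos b (fun n => by positivity)
    (hasSum_geometric_two' 1) φ hm hi h1 hqφ
  have hint := (hC _ hmem).1
  have hbound : ∀ n x, 2 ^ n / 2 * |φ n x| ≤ |(∑' m, b m * φ m x) * g x| := fun n x => by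
    by_cases hx : x ∈ {x | ⌊|g x|⌋₊ = k n} ∩ Ioc c a
    · have hne : ∀ m ≠ n, b m * φ m x = 0 := fun m hmn => by
        rw [hz m x fun h' => hmn (hk.injective (h'.1.symm.trans hx.1)), mul_zero]
      have hgx : (4 : ℝ) ^ n ≤ |g x| := by
        have h4 : ((4 ^ n : ℕ) : ℝ) ≤ (⌊|g x|⌋₊ : ℝ) := by
          rw [show ⌊|g x|⌋₊ = k n from hx.1]
          exact_mod_cast (hkn n).2
        push_cast at h4
        exact h4.trans (Nat.floor_le (abs_nonneg _))
      rw [tsum_eq_single n hne, abs_mul, abs_mul, abs_of_nonneg (by positivity : 0 ≤ b n)]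
      calc 2 ^ n / 2 * |φ n x| = b n * |φ n x| * 4 ^ n := by
            rw [hb, show (4 : ℝ) = 2 * 2 by norm_num, mul_pow]
            field_simp
        _ ≤ _ := by gcongr
    · rw [hz n x hx, abs_zero, mul_zero]
      positivity
  have hall : ∀ n : ℕ, (2 : ℝ) ^ n / 2 ≤ ∫ x in Ioo c d, |(∑' m, b m * φ m x) * g x| := fun n =>
    calc (2 : ℝ) ^ n / 2 = ∫ x in Ioo c d, 2 ^ n / 2 * |φ n x| := by
          rw [integral_const_mul, setIntegral_eq_integral_of_forall_compl_eq_zero, h1, mul_one]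
          intro x hx
          rw [hz n x fun h' => hx (hsub h'.2), abs_zero]
      _ ≤ _ := integral_mono ((hi n).abs.const_mul _).integrableOn hint.abs (hbound n)
  obtain ⟨n, hn⟩ := pow_unbounded_of_one_lt
    (2 * ∫ x in Ioo c d, |(∑' m, b m * φ m x) * g x|) (one_lt_two (α := ℝ))
  linarith [hall n]
end

section
/- Let I = (c,d) ⊂ ℝ, p ∈ (1,∞), w : I → (0,∞) measurable with ∫_x^d w^p < ∞ for all x ∈ I. Then for every nonzero f ∈ Cs_{p,w}(I), sup over measurable h ≥ 0 with 0 < ‖h/w‖_{L^{p'}(I)} < ∞ of [∫_I |f(x)| (∫_x^d h) dx] / ‖h/w‖_{L^{p'}(I)} = (∫_I [w(x) ∫_c^x |f|]^p dx)^{1/p}. -/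
open MeasureTheory Set Filter

/-- seminorm of the weighted Cesàro space -/
noncomputable def csNorm (c d p : ℝ) (w f : ℝ → ℝ) : ℝ :=
  (∫ x in Ioo c d, (w x * ∫ t in Ioc c x, |f t|) ^ p) ^ (1/p)

theorem measurable_setLIntegral_prodMk_preimage {s : Set (ℝ × ℝ)} (hs : MeasurableSet s)
    {g : ℝ → ENNReal} (hg : Measurable g) :
    Measurable fun x => ∫⁻ t in Prod.mk x ⁻¹' s, g t := by
  have key : Measurable fun x => ∫⁻ t, s.indicator (fun z => g z.2) (x, t) :=
    ((hg.comp measurable_snd).indicator hs).lintegral_prod_right'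
  convert key using 1
  funext x
  rw [← lintegral_indicator (measurable_prodMk_left hs)]
  rfl

theorem measurable_setLIntegral_Ioc (c : ℝ) {g : ℝ → ENNReal} (hg : Measurable g) :
    Measurable fun x => ∫⁻ t in Ioc c x, g t := by
  have hs : MeasurableSet {z : ℝ × ℝ | c < z.2 ∧ z.2 ≤ z.1} :=
    (measurableSet_lt measurable_const measurable_snd).inter
      (measurableSet_le measurable_snd measurable_fst)
  exact measurable_setLIntegral_prodMk_preimage hs hg

theorem measurable_setLIntegral_Ioo (d : ℝ) {g : ℝ → ENNReal} (hg : Measurable g) :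
    Measurable fun x => ∫⁻ t in Ioo x d, g t := by
  have hs : MeasurableSet {z : ℝ × ℝ | z.1 < z.2 ∧ z.2 < d} :=
    (measurableSet_lt measurable_fst measurable_snd).inter
      (measurableSet_lt measurable_snd measurable_const)
  exact measurable_setLIntegral_prodMk_preimage hs hg

/-- Tonelli's theorem on the triangle `c < x < y < d`. -/
theorem lintegral_mul_setLIntegral_swap (c d : ℝ) {g k : ℝ → ENNReal}
    (hg : Measurable g) (hk : Measurable k) :
    ∫⁻ x in Ioo c d, g x * ∫⁻ t in Ioo x d, k t =
      ∫⁻ y in Ioo c d, k y * ∫⁻ t in Ioc c y, g t := by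
  set T : Set (ℝ × ℝ) := {z | c < z.1 ∧ z.1 < z.2 ∧ z.2 < d} with hT
  have hTm : MeasurableSet T :=
    (measurableSet_lt measurable_const measurable_fst).inter
      ((measurableSet_lt measurable_fst measurable_snd).inter
        (measurableSet_lt measurable_snd measurable_const))
  have hm : Measurable (T.indicator fun z => g z.1 * k z.2) :=
    ((hg.comp measurable_fst).mul (hk.comp measurable_snd)).indicator hTm
  have hl : ∫⁻ x in Ioo c d, g x * ∫⁻ t in Ioo x d, k t =
      ∫⁻ x, ∫⁻ y, T.indicator (fun z => g z.1 * k z.2) (x, y) := by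
    rw [← lintegral_indicator measurableSet_Ioo]
    refine lintegral_congr fun x => ?_
    by_cases hx : x ∈ Ioo c d
    · rw [indicator_of_mem hx, ← lintegral_const_mul _ hk, ← lintegral_indicator measurableSet_Ioo]
      refine lintegral_congr fun y => ?_
      simp [indicator, hT, hx.1]
    · rw [indicator_of_notMem hx]
      refine (lintegral_eq_zero_of_ae_eq_zero (ae_of_all _ fun y => ?_)).symm
      exact indicator_of_notMem (fun h => hx ⟨h.1, h.2.1.trans h.2.2⟩) _
  have hr : ∫⁻ y in Ioo c d, k y * ∫⁻ t in Ioc c y, g t =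
      ∫⁻ y, ∫⁻ x, T.indicator (fun z => g z.1 * k z.2) (x, y) := by
    rw [← lintegral_indicator measurableSet_Ioo]
    refine lintegral_congr fun y => ?_
    by_cases hy : y ∈ Ioo c d
    · rw [indicator_of_mem hy, ← restrict_Ioo_eq_restrict_Ioc, ← lintegral_const_mul _ hg,
        ← lintegral_indicator measurableSet_Ioo]
      refine lintegral_congr fun x => ?_
      simp [indicator, hT, hy.2, mul_comm]
    · rw [indicator_of_notMem hy]
      refine (lintegral_eq_zero_of_ae_eq_zero (ae_of_all _ fun x => ?_)).symm
      exact indicator_of_notMem (fun h => hy ⟨h.1.trans h.2.1, h.2.2⟩) _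
  rw [hl, hr]
  exact lintegral_lintegral_swap hm.aemeasurable

theorem measurable_setIntegral_Ioc_abs (c : ℝ) {f : ℝ → ℝ} (hf : Measurable f) :
    Measurable fun x => ∫ t in Ioc c x, |f t| := by
  convert (measurable_setLIntegral_Ioc c hf.enorm).ennreal_toReal using 1
  funext x
  exact integral_norm_eq_lintegral_enorm hf.aestronglyMeasurable

theorem measurable_setIntegral_Ioo_abs (d : ℝ) {f : ℝ → ℝ} (hf : Measurable f) :
    Measurable fun x => ∫ t in Ioo x d, |f t| := by
  convert (measurable_setLIntegral_Ioo d hf.enorm).ennreal_toReal using 1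
  funext x
  exact integral_norm_eq_lintegral_enorm hf.aestronglyMeasurable

theorem setIntegral_abs_nonneg (s : Set ℝ) (f : ℝ → ℝ) : 0 ≤ ∫ t in s, |f t| :=
  integral_nonneg fun _ => abs_nonneg _

theorem integral_abs_mul_setIntegral_swap (c d : ℝ) {f h : ℝ → ℝ} (hf : Measurable f)
    (hh : Measurable h) (hfi : ∀ x ∈ Ioo c d, IntegrableOn f (Ioc c x))
    (hhi : ∀ x ∈ Ioo c d, IntegrableOn h (Ioo x d)) :
    ∫ x in Ioo c d, |f x| * ∫ t in Ioo x d, |h t| =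
      ∫ y in Ioo c d, |h y| * ∫ t in Ioc c y, |f t| := by
  rw [integral_eq_lintegral_of_nonneg_ae
      (ae_of_all _ fun x => mul_nonneg (abs_nonneg _) (setIntegral_abs_nonneg _ h))
      (hf.abs.mul (measurable_setIntegral_Ioo_abs d hh)).aestronglyMeasurable,
    integral_eq_lintegral_of_nonneg_ae
      (ae_of_all _ fun x => mul_nonneg (abs_nonneg _) (setIntegral_abs_nonneg _ f))
      (hh.abs.mul (measurable_setIntegral_Ioc_abs c hf)).aestronglyMeasurable]
  congr 1
  refine Eq.trans ?_ ((lintegral_mul_setLIntegral_swap c d hf.enorm hh.enorm).trans ?_)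
  · refine setLIntegral_congr_fun measurableSet_Ioo fun x hx => ?_
    rw [ENNReal.ofReal_mul (abs_nonneg _), ← Real.enorm_eq_ofReal_abs]
    congr 1
    exact ofReal_integral_norm_eq_lintegral_enorm (hhi x hx)
  · refine setLIntegral_congr_fun measurableSet_Ioo fun x hx => ?_
    rw [ENNReal.ofReal_mul (abs_nonneg _), ← Real.enorm_eq_ofReal_abs]
    congr 1
    exact (ofReal_integral_norm_eq_lintegral_enorm (hfi x hx)).symm

theorem memLp_ofReal_of_integrable_abs_rpow_s13 {μ : Measure ℝ} {r : ℝ} (hr : 0 < r) {u : ℝ → ℝ}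
    (hu : Measurable u) (hi : Integrable (fun x => |u x| ^ r) μ) :
    MemLp u (ENNReal.ofReal r) μ := by
  rw [← integrable_norm_rpow_iff hu.aestronglyMeasurable (by simpa using hr) (by simp),
    ENNReal.toReal_ofReal hr.le]
  exact hi

theorem mul_rpow_sub_one_le_add {a b p : ℝ} (ha : 0 ≤ a) (hb : 0 ≤ b) (hp : 1 < p) :
    a * b ^ (p - 1) ≤ a ^ p + b ^ p := by
  have split : ∀ {t : ℝ}, 0 ≤ t → t * t ^ (p - 1) = t ^ p := fun {t} ht => by
    rw [← Real.rpow_one_add' ht (by linarith)]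
    congr 1
    ring
  rcases le_total a b with hab | hab
  · calc a * b ^ (p - 1) ≤ b * b ^ (p - 1) := by gcongr
      _ = b ^ p := split hb
      _ ≤ a ^ p + b ^ p := le_add_of_nonneg_left (by positivity)
  · calc a * b ^ (p - 1) ≤ a * a ^ (p - 1) := by
          gcongr
      _ = a ^ p := split ha
      _ ≤ a ^ p + b ^ p := le_add_of_nonneg_right (by positivity)

theorem stmt13 (c d p q : ℝ) (hcd : c < d) (hp : 1 < p) (hq : q = p / (p - 1))
    (w : ℝ → ℝ) (hwm : Measurable w)
    (hwpos : ∀ x ∈ Ioo c d, 0 < w x)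
    (hwint : ∀ x ∈ Ioo c d, IntegrableOn (fun t => w t ^ p) (Ioo x d))
    (f : ℝ → ℝ) (hf : memCs c d p w f) (hf0 : csNorm c d p w f ≠ 0) :
    (⨆ h : ℝ → ℝ, ⨆ _ : Measurable h ∧ (∀ x, 0 ≤ h x) ∧
        (∀ x ∈ Ioo c d, IntegrableOn h (Ioo x d)) ∧
        IntegrableOn (fun x => |h x / w x| ^ q) (Ioo c d) ∧
        (∫ x in Ioo c d, |h x / w x| ^ q) ^ (1/q) ≠ 0,
      ENNReal.ofReal ((∫ x in Ioo c d, |f x| * ∫ t in Ioo x d, h t) /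
        (∫ x in Ioo c d, |h x / w x| ^ q) ^ (1/q)))
    = ENNReal.ofReal (csNorm c d p w f) := by
  obtain ⟨hfm, hfi, hfp⟩ := hf
  have hp0 : 0 < p := by linarith
  have hp1 : 0 < p - 1 := by linarith
  have hq0 : 0 < q := hq ▸ div_pos hp0 hp1
  have hpq : p.HolderConjugate q := hq ▸ Real.HolderConjugate.conjExponent hp
  set F : ℝ → ℝ := fun x => ∫ t in Ioc c x, |f t| with hF
  have hFm : Measurable F := measurable_setIntegral_Ioc_abs c hfm
  have hF0 : ∀ x, 0 ≤ F x := fun x => setIntegral_abs_nonneg _ f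
  have hwF0 : ∀ x ∈ Ioo c d, 0 ≤ w x * F x := fun x hx => mul_nonneg (hwpos x hx).le (hF0 x)
  have swap : ∀ h : ℝ → ℝ, Measurable h → (∀ x, 0 ≤ h x) →
      (∀ x ∈ Ioo c d, IntegrableOn h (Ioo x d)) →
      ∫ x in Ioo c d, |f x| * ∫ t in Ioo x d, h t = ∫ y in Ioo c d, h y * F y := by
    intro h hm h0 hi
    simpa only [abs_of_nonneg (h0 _)] using integral_abs_mul_setIntegral_swap c d hfm hm hfi hi
  refine le_antisymm (iSup₂_le ?_) ?_
  · rintro h ⟨hm, h0, hi, hLq, hne⟩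
    refine ENNReal.ofReal_le_ofReal ?_
    have hN : 0 ≤ (∫ x in Ioo c d, |h x / w x| ^ q) ^ (1 / q) :=
      Real.rpow_nonneg (integral_nonneg fun _ => by positivity) _
    rw [swap h hm h0 hi, div_le_iff₀ (hN.lt_of_ne' hne)]
    have hwF : IntegrableOn (fun x => |w x * F x| ^ p) (Ioo c d) :=
      hfp.congr_fun (fun x hx => by rw [abs_of_nonneg (hwF0 x hx)]) measurableSet_Ioo
    calc ∫ y in Ioo c d, h y * F y = ∫ y in Ioo c d, (w y * F y) * (h y / w y) :=
          setIntegral_congr_fun measurableSet_Ioo fun y hy => by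
            have := (hwpos y hy).ne'
            field_simp
      _ ≤ (∫ y in Ioo c d, (w y * F y) ^ p) ^ (1 / p) *
            (∫ y in Ioo c d, (h y / w y) ^ q) ^ (1 / q) :=
          integral_mul_le_Lp_mul_Lq_of_nonneg hpq
            ((ae_restrict_iff' measurableSet_Ioo).2 (ae_of_all _ hwF0))
            ((ae_restrict_iff' measurableSet_Ioo).2 (ae_of_all _ fun y hy =>
              div_nonneg (h0 y) (hwpos y hy).le))
            (memLp_ofReal_of_integrable_abs_rpow_s13 hp0 (hwm.mul hFm) hwF)
            (memLp_ofReal_of_integrable_abs_rpow_s13 hq0 (hm.div hwm) hLq)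
      _ = csNorm c d p w f * (∫ x in Ioo c d, |h x / w x| ^ q) ^ (1 / q) := by
          unfold csNorm
          congr 2
          exact setIntegral_congr_fun measurableSet_Ioo fun y hy => by
            rw [abs_of_nonneg (div_nonneg (h0 y) (hwpos y hy).le)]
  · set h : ℝ → ℝ := (Ioo c d).indicator fun x => w x * (w x * F x) ^ (p - 1) with hh
    have hval : ∀ x ∈ Ioo c d, h x = w x * (w x * F x) ^ (p - 1) := fun x hx =>
      indicator_of_mem hx _
    have hm : Measurable h :=
      (hwm.mul ((hwm.mul hFm).pow_const _)).indicator measurableSet_Ioo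
    have h0 : ∀ x, 0 ≤ h x := fun x => indicator_nonneg
      (fun x hx => mul_nonneg (hwpos x hx).le (Real.rpow_nonneg (hwF0 x hx) _)) x
    have hi : ∀ x ∈ Ioo c d, IntegrableOn h (Ioo x d) := by
      intro x hx
      have hsub : Ioo x d ⊆ Ioo c d := Ioo_subset_Ioo_left hx.1.le
      refine ((hwint x hx).add (hfp.mono_set hsub)).mono' hm.aestronglyMeasurable
        ((ae_restrict_iff' measurableSet_Ioo).2 (ae_of_all _ fun y hy => ?_))
      rw [Real.norm_of_nonneg (h0 y), hval y (hsub hy)]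
      exact mul_rpow_sub_one_le_add (hwpos y (hsub hy)).le (hwF0 y (hsub hy)) hp
    have hpow : ∀ x ∈ Ioo c d, |h x / w x| ^ q = (w x * F x) ^ p := by
      intro x hx
      rw [hval x hx, mul_div_cancel_left₀ _ (hwpos x hx).ne',
        abs_of_nonneg (Real.rpow_nonneg (hwF0 x hx) _), ← Real.rpow_mul (hwF0 x hx), hq,
        mul_div_cancel₀ _ hp1.ne']
    have hint : ∫ x in Ioo c d, |h x / w x| ^ q = ∫ x in Ioo c d, (w x * F x) ^ p :=
      setIntegral_congr_fun measurableSet_Ioo hpow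
    have hnum : ∫ y in Ioo c d, h y * F y = ∫ x in Ioo c d, (w x * F x) ^ p :=
      setIntegral_congr_fun measurableSet_Ioo fun x hx => by
        rw [hval x hx, mul_right_comm, ← Real.rpow_one_add' (hwF0 x hx) (by linarith)]
        congr 1
        ring
    have hcs : csNorm c d p w f = (∫ x in Ioo c d, (w x * F x) ^ p) ^ (1 / p) := rfl
    have hJ0 : 0 ≤ ∫ x in Ioo c d, (w x * F x) ^ p :=
      setIntegral_nonneg measurableSet_Ioo fun x hx => Real.rpow_nonneg (hwF0 x hx) _
    have hJ : 0 < ∫ x in Ioo c d, (w x * F x) ^ p := by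
      refine hJ0.lt_of_ne' fun hzero => hf0 ?_
      rw [hcs, hzero, Real.zero_rpow (one_div_pos.2 hp0).ne']
    refine le_iSup₂_of_le h ⟨hm, h0, hi, ?_, ?_⟩ (le_of_eq ?_)
    · exact hfp.congr_fun (fun x hx => (hpow x hx).symm) measurableSet_Ioo
    · rw [hint]
      exact (Real.rpow_pos_of_pos hJ _).ne'
    · rw [swap h hm h0 hi, hnum, hint, hcs]
      congr 1
      rw [eq_div_iff (Real.rpow_pos_of_pos hJ _).ne', ← Real.rpow_add hJ]
      have : 1 / p + 1 / q = 1 := by simpa using hpq.inv_add_inv_eq_one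
      rw [this, Real.rpow_one]
end
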